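/- arXiv:0705.2273 — 2 statements merged into one kernel-verified Lean document; each statement's English description precedes it below -/
import Mathlib

section
/- In the complex Grassmann manifold G_{n,1}(ℂ) = ℂP^{n-1} with chordal distance d_c(P,Q) = sqrt(1 - |⟨u,v⟩|²) and the unitary-invariant probability measure μ, the volume of a metric ball of radius δ ≤ 1 equals δ^{2(n-1)}. -/
open scoped InnerProductSpace LinearAlgebra.Projectivization
open MeasureTheory

/-- The Borel measurable structure on `ℂⁿ`. -/
noncomputable instance euclideanComplexMeasurableSpace (n : ℕ) :
    MeasurableSpace (EuclideanSpace ℂ (Fin n)) := borel _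

/-- The quotient measurable structure on the projective space `ℙ ℂ ℂⁿ`. -/
noncomputable instance projMeasurableSpace (n : ℕ) :
    MeasurableSpace (ℙ ℂ (EuclideanSpace ℂ (Fin n))) :=
  inferInstanceAs (MeasurableSpace (Quotient _))

instance euclideanComplexBorelSpace (n : ℕ) : BorelSpace (EuclideanSpace ℂ (Fin n)) := ⟨rfl⟩

/-- The isometry group of `ℂⁿ` acts transitively on unit vectors. -/
theorem exists_linearIsometryEquiv_apply_eq {n : ℕ} {u v : EuclideanSpace ℂ (Fin n)}
    (hu : ‖u‖ = 1) (hv : ‖v‖ = 1) :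
    ∃ A : EuclideanSpace ℂ (Fin n) ≃ₗᵢ[ℂ] EuclideanSpace ℂ (Fin n), A u = v := by
  have key : ∀ {w : EuclideanSpace ℂ (Fin n)}, ‖w‖ = 1 → ∀ i : Fin n,
      ∃ b : OrthonormalBasis (Fin n) ℂ (EuclideanSpace ℂ (Fin n)), b i = w := by
    intro w hw i
    obtain ⟨b, hb⟩ := Orthonormal.exists_orthonormalBasis_extension_of_card_eq (𝕜 := ℂ)
      (E := EuclideanSpace ℂ (Fin n)) (ι := Fin n) (by simp) (v := fun _ => w) (s := {i})
      ⟨fun _ => hw, fun a b hab => (hab (Subsingleton.elim a b)).elim⟩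
    exact ⟨b, hb i rfl⟩
  rcases Nat.eq_zero_or_pos n with rfl | hn
  · exact ⟨LinearIsometryEquiv.refl ℂ _, Subsingleton.elim _ _⟩
  obtain ⟨b, hb⟩ := key hu ⟨0, hn⟩
  obtain ⟨b', hb'⟩ := key hv ⟨0, hn⟩
  exact ⟨b.equiv b' (Equiv.refl _), by rw [← hb, OrthonormalBasis.equiv_apply_basis]; simpa using hb'⟩

/-- The squared norm of the orthogonal projection of `v` onto the line `Q`. -/
noncomputable def sqNormProj {n : ℕ} (v : EuclideanSpace ℂ (Fin n))
    (Q : ℙ ℂ (EuclideanSpace ℂ (Fin n))) : ℝ :=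
  ‖⟪v, Q.rep⟫_ℂ‖ ^ 2 / ‖Q.rep‖ ^ 2

theorem sqNormProj_mk {n : ℕ} (v w : EuclideanSpace ℂ (Fin n)) (hw : w ≠ 0) :
    sqNormProj v (Projectivization.mk ℂ w hw) = ‖⟪v, w⟫_ℂ‖ ^ 2 / ‖w‖ ^ 2 := by
  obtain ⟨a, ha⟩ := Projectivization.exists_smul_eq_mk_rep ℂ w hw
  have ha0 : ‖(a : ℂ)‖ ≠ 0 := by simp
  rw [sqNormProj, ← ha, Units.smul_def, inner_smul_right, norm_mul, norm_smul, mul_pow, mul_pow,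
    mul_div_mul_left _ _ (pow_ne_zero 2 ha0)]

/-- The matrix entries of the orthogonal projection onto a line. -/
noncomputable def projEntry {n : ℕ} (i j : Fin n) (Q : ℙ ℂ (EuclideanSpace ℂ (Fin n))) : ℂ :=
  Q.rep i * star (Q.rep j) / (‖Q.rep‖ : ℂ) ^ 2

theorem projEntry_mk {n : ℕ} (i j : Fin n) (w : EuclideanSpace ℂ (Fin n)) (hw : w ≠ 0) :
    projEntry i j (Projectivization.mk ℂ w hw) = w i * star (w j) / (‖w‖ : ℂ) ^ 2 := by
  obtain ⟨a, ha⟩ := Projectivization.exists_smul_eq_mk_rep ℂ w hw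
  have ha0 : (a : ℂ) * star (a : ℂ) ≠ 0 := by simp
  have hn : ((‖(a : ℂ)‖ : ℝ) : ℂ) ^ 2 = a * star (a : ℂ) := by
    simpa using (Complex.mul_conj' (a : ℂ)).symm
  rw [projEntry, ← ha, Units.smul_def, norm_smul, Complex.ofReal_mul, mul_pow, hn,
    ← mul_div_mul_left (w i * star (w j)) _ ha0]
  simp only [PiLp.smul_apply, smul_eq_mul, star_mul]
  ring

theorem measurable_projEntry {n : ℕ} (i j : Fin n) :
    Measurable (projEntry i j : ℙ ℂ (EuclideanSpace ℂ (Fin n)) → ℂ) := by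
  have hq : Measurable fun w : {w : EuclideanSpace ℂ (Fin n) // w ≠ 0} =>
      (w : EuclideanSpace ℂ (Fin n)) i * star ((w : EuclideanSpace ℂ (Fin n)) j) /
        (‖(w : EuclideanSpace ℂ (Fin n))‖ : ℂ) ^ 2 := by
    have hc : ∀ k : Fin n, Measurable fun w : EuclideanSpace ℂ (Fin n) => w k := fun k =>
      (EuclideanSpace.proj (𝕜 := ℂ) k).continuous.measurable
    have hs : Measurable fun w : EuclideanSpace ℂ (Fin n) => star (w j) :=
      continuous_star.measurable.comp (hc j)
    have hn : Measurable fun w : EuclideanSpace ℂ (Fin n) => ((‖w‖ : ℝ) : ℂ) :=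
      (Complex.continuous_ofReal.comp continuous_norm).measurable
    exact (((hc i).mul hs).div (hn.pow_const 2)).comp measurable_subtype_coe
  refine measurable_from_quotient.2 ?_
  convert hq using 2 with w
  exact projEntry_mk i j w.1 w.2

theorem sqNormProj_eq_sum {n : ℕ} (v : EuclideanSpace ℂ (Fin n))
    (Q : ℙ ℂ (EuclideanSpace ℂ (Fin n))) :
    sqNormProj v Q = (∑ i, ∑ j, star (v i) * v j * projEntry i j Q).re := by
  have h : ((sqNormProj v Q : ℝ) : ℂ) = ∑ i, ∑ j, star (v i) * v j * projEntry i j Q := by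
    have h1 : ((‖⟪v, Q.rep⟫_ℂ‖ : ℝ) : ℂ) ^ 2 = ⟪v, Q.rep⟫_ℂ * star ⟪v, Q.rep⟫_ℂ := by
      simpa using (Complex.mul_conj' ⟪v, Q.rep⟫_ℂ).symm
    rw [sqNormProj, Complex.ofReal_div, Complex.ofReal_pow, Complex.ofReal_pow, h1,
      PiLp.inner_apply, star_sum, Finset.sum_mul_sum, Finset.sum_div]
    refine Finset.sum_congr rfl fun i _ => ?_
    rw [Finset.sum_div]
    refine Finset.sum_congr rfl fun j _ => ?_
    simp only [projEntry, RCLike.inner_apply, star_mul, RCLike.star_def, RCLike.conj_conj]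
    ring
  rw [← h, Complex.ofReal_re]

theorem measurable_sqNormProj {n : ℕ} :
    Measurable fun p : EuclideanSpace ℂ (Fin n) × ℙ ℂ (EuclideanSpace ℂ (Fin n)) =>
      sqNormProj p.1 p.2 := by
  simp only [sqNormProj_eq_sum]
  have hc : ∀ k : Fin n, Measurable fun w : EuclideanSpace ℂ (Fin n) => w k := fun k =>
    (EuclideanSpace.proj (𝕜 := ℂ) k).continuous.measurable
  refine Complex.measurable_re.comp (Finset.measurable_sum _ fun i _ =>
    Finset.measurable_sum _ fun j _ => ?_)
  exact ((continuous_star.measurable.comp ((hc i).comp measurable_fst)).mul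
    ((hc j).comp measurable_fst)).mul ((measurable_projEntry i j).comp measurable_snd)

theorem lintegral_gaussian_outside_disc {c s : ℝ} (hc : 0 < c) (hs : 0 ≤ s) :
    ∫⁻ z : ℂ, {z : ℂ | s ≤ ‖z‖ ^ 2}.indicator
      (fun z => ENNReal.ofReal (Real.exp (-c * ‖z‖ ^ 2))) z =
      ENNReal.ofReal (Real.pi / c * Real.exp (-c * s)) := by
  have hderiv : ∀ r : ℝ, HasDerivAt (fun r : ℝ => -(1 / (2 * c)) * Real.exp (-c * r ^ 2))
      (r * Real.exp (-c * r ^ 2)) r := by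
    intro r
    have h := (((hasDerivAt_pow 2 r).const_mul (-c)).exp).const_mul (-(1 / (2 * c)))
    refine h.congr_deriv ?_
    push_cast
    field_simp
  have hlim : Filter.Tendsto (fun r : ℝ => -(1 / (2 * c)) * Real.exp (-c * r ^ 2))
      Filter.atTop (nhds 0) := by
    have h : Filter.Tendsto (fun r : ℝ => -c * r ^ 2) Filter.atTop Filter.atBot :=
      (Filter.tendsto_pow_atTop two_ne_zero).const_mul_atTop_of_neg (by linarith)
    simpa using (Real.tendsto_exp_atBot.comp h).const_mul (-(1 / (2 * c)))
  have hnn : ∀ r ∈ Set.Ioi √s, 0 ≤ r * Real.exp (-c * r ^ 2) := fun r hr =>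
    mul_nonneg ((Real.sqrt_nonneg s).trans (le_of_lt hr)) (Real.exp_nonneg _)
  have hcont : ContinuousWithinAt (fun r : ℝ => -(1 / (2 * c)) * Real.exp (-c * r ^ 2))
      (Set.Ici √s) √s := (hderiv _).continuousAt.continuousWithinAt
  have hint := integrableOn_Ioi_deriv_of_nonneg hcont (fun r _ => hderiv r) hnn hlim
  have hval := integral_Ioi_of_hasDerivAt_of_nonneg hcont (fun r _ => hderiv r) hnn hlim
  have hrad : ∫⁻ r in Set.Ioi (0 : ℝ), (Set.Ici √s).indicator
      (fun r => ENNReal.ofReal (r * Real.exp (-c * r ^ 2))) r =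
      ENNReal.ofReal (1 / (2 * c) * Real.exp (-c * s)) := by
    rw [setLIntegral_indicator measurableSet_Ici]
    have hset : (Set.Ici √s ∩ Set.Ioi 0 : Set ℝ) =ᵐ[volume] Set.Ioi √s := by
      have h1 : (Set.Ici √s ∩ Set.Ioi 0 : Set ℝ) =ᵐ[volume] (Set.Ioi √s ∩ Set.Ioi 0 : Set ℝ) :=
        Ioi_ae_eq_Ici.symm.inter (Filter.EventuallyEq.refl _ _)
      rwa [Set.inter_eq_left.2 (Set.Ioi_subset_Ioi (Real.sqrt_nonneg s))] at h1
    rw [setLIntegral_congr hset, ← ofReal_integral_eq_lintegral_ofReal hint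
      (ae_restrict_of_forall_mem measurableSet_Ioi hnn), hval, Real.sq_sqrt hs]
    congr 1
    ring
  rw [← Complex.lintegral_comp_polarCoord_symm]
  have hfun : ∀ p ∈ polarCoord.target, ENNReal.ofReal p.1 •
      {z : ℂ | s ≤ ‖z‖ ^ 2}.indicator (fun z => ENNReal.ofReal (Real.exp (-c * ‖z‖ ^ 2)))
        (Complex.polarCoord.symm p) =
      (Set.Ici √s).indicator (fun r => ENNReal.ofReal (r * Real.exp (-c * r ^ 2))) p.1 := by
    rintro ⟨r, θ⟩ hp
    have hr : 0 < r := hp.1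
    have hnorm : ‖Complex.polarCoord.symm (r, θ)‖ = r := by
      simp [abs_of_pos hr]
    by_cases h : √s ≤ r
    · have h' : s ≤ r ^ 2 := (Real.sqrt_le_left hr.le).1 h
      rw [Set.indicator_of_mem (by simpa only [Set.mem_ofPred_eq, hnorm]),
        Set.indicator_of_mem (by exact h), hnorm, smul_eq_mul, ENNReal.ofReal_mul hr.le]
    · have h' : ¬ s ≤ r ^ 2 := fun h2 => h ((Real.sqrt_le_left hr.le).2 h2)
      rw [Set.indicator_of_notMem (by simpa only [Set.mem_ofPred_eq, hnorm]),
        Set.indicator_of_notMem (by exact h), smul_zero]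
  have hmeas : Measurable ((Set.Ici √s).indicator
      (fun r : ℝ => ENNReal.ofReal (r * Real.exp (-c * r ^ 2)))) :=
    Measurable.indicator (by fun_prop) measurableSet_Ici
  have htarget : MeasurableSet polarCoord.target := polarCoord.open_target.measurableSet
  rw [setLIntegral_congr_fun htarget hfun, polarCoord_target, Measure.volume_eq_prod,
    ← Measure.prod_restrict, lintegral_prod _ (by exact (hmeas.comp measurable_fst).aemeasurable)]
  simp only [lintegral_const, Measure.restrict_apply MeasurableSet.univ, Set.univ_inter,
    Real.volume_Ioo]
  rw [lintegral_mul_const _ hmeas, hrad, ← ENNReal.ofReal_mul (by positivity)]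
  congr 1
  field_simp
  ring

theorem lintegral_fin_succ {m : ℕ} {f : (Fin (m + 1) → ℂ) → ENNReal} (hf : Measurable f) :
    ∫⁻ x, f x = ∫⁻ w : Fin m → ℂ, ∫⁻ z : ℂ, f (Fin.cons z w) := by
  have hmp := (volume_preserving_piFinSuccAbove (fun _ : Fin (m + 1) => ℂ) 0).symm
  rw [← hmp.lintegral_comp_emb (MeasurableEquiv.measurableEmbedding _), Measure.volume_eq_prod,
    lintegral_prod_symm' _ (by exact hf.comp (MeasurableEquiv.measurable _))]
  simp [MeasurableEquiv.piFinSuccAbove, Fin.insertNthEquiv]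

theorem lintegral_gaussian_pi (m : ℕ) {c : ℝ} (hc : 0 < c) :
    ∫⁻ x : Fin m → ℂ, ENNReal.ofReal (Real.exp (-c * ∑ i, ‖x i‖ ^ 2)) =
      ENNReal.ofReal ((Real.pi / c) ^ m) := by
  induction m with
  | zero => simp [volume_pi]
  | succ m ih =>
    rw [lintegral_fin_succ (by fun_prop)]
    have hz := lintegral_gaussian_outside_disc hc le_rfl
    simp only [sq_nonneg, Set.ofPred_true, Set.indicator_univ, mul_zero, Real.exp_zero,
      mul_one] at hz
    simp_rw [Fin.sum_univ_succ, Fin.cons_zero, Fin.cons_succ, mul_add, Real.exp_add,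
      ENNReal.ofReal_mul (Real.exp_nonneg _)]
    simp_rw [lintegral_mul_const' _ _ ENNReal.ofReal_ne_top, hz]
    rw [lintegral_const_mul' _ _ ENNReal.ofReal_ne_top, ih, ← ENNReal.ofReal_mul (by positivity),
      pow_succ']

/-- The Gaussian measure with density `exp (-‖v‖²)` on `ℂⁿ` (not normalized). -/
noncomputable def complexGaussian (n : ℕ) : Measure (EuclideanSpace ℂ (Fin n)) :=
  ((volume : Measure (Fin n → ℂ)).map
    (PiLp.continuousLinearEquiv 2 ℂ (fun _ : Fin n => ℂ)).symm).withDensity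
      fun v => ENNReal.ofReal (Real.exp (-‖v‖ ^ 2))

theorem complexGaussian_apply {n : ℕ} {S : Set (EuclideanSpace ℂ (Fin n))}
    (hS : MeasurableSet S) :
    complexGaussian n S = ∫⁻ x : Fin n → ℂ, {x | WithLp.toLp 2 x ∈ S}.indicator
      (fun x => ENNReal.ofReal (Real.exp (-∑ i, ‖x i‖ ^ 2))) x := by
  have hd : Measurable fun v : EuclideanSpace ℂ (Fin n) =>
      ENNReal.ofReal (Real.exp (-‖v‖ ^ 2)) := by
    have : Continuous fun v : EuclideanSpace ℂ (Fin n) => Real.exp (-‖v‖ ^ 2) := by fun_prop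
    exact ENNReal.measurable_ofReal.comp this.measurable
  rw [complexGaussian, withDensity_apply _ hS, ← lintegral_indicator hS,
    lintegral_map (hd.indicator hS)
      (PiLp.continuousLinearEquiv 2 ℂ (fun _ : Fin n => ℂ)).symm.continuous.measurable]
  refine lintegral_congr fun x => ?_
  by_cases h : WithLp.toLp 2 x ∈ S
  · rw [Set.indicator_of_mem (by exact h), Set.indicator_of_mem (by exact h),
      EuclideanSpace.norm_sq_eq]
    rfl
  · rw [Set.indicator_of_notMem (by exact h), Set.indicator_of_notMem (by exact h)]

theorem complexGaussian_univ (n : ℕ) :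
    complexGaussian n Set.univ = ENNReal.ofReal (Real.pi ^ n) := by
  have h := lintegral_gaussian_pi n one_pos
  simp only [neg_mul, one_mul, div_one] at h
  simpa using (complexGaussian_apply MeasurableSet.univ).trans (by simpa using h)

instance isFiniteMeasure_complexGaussian (n : ℕ) : IsFiniteMeasure (complexGaussian n) :=
  ⟨by rw [complexGaussian_univ]; exact ENNReal.ofReal_lt_top⟩

theorem ae_complexGaussian_ne_zero (m : ℕ) : ∀ᵐ v ∂complexGaussian (m + 1), v ≠ 0 := by
  have : (volume : Measure (Fin (m + 1) → ℂ)) {0} = 0 := measure_singleton _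
  refine (withDensity_absolutelyContinuous _ _).ae_le ?_
  refine (ae_map_iff
    (PiLp.continuousLinearEquiv 2 ℂ (fun _ => ℂ)).symm.continuous.measurable.aemeasurable
    (measurableSet_singleton 0).compl).2 ?_
  filter_upwards [(measure_eq_zero_iff_ae_notMem).1 this] with x hx h
  exact hx (by simpa using h)

theorem complexGaussian_preimage {n : ℕ}
    (A : EuclideanSpace ℂ (Fin n) ≃ₗᵢ[ℂ] EuclideanSpace ℂ (Fin n))
    {S : Set (EuclideanSpace ℂ (Fin n))} (hS : MeasurableSet S) :
    complexGaussian n (A ⁻¹' S) = complexGaussian n S := by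
  set ν : Measure (EuclideanSpace ℂ (Fin n)) := (volume : Measure (Fin n → ℂ)).map
    (PiLp.continuousLinearEquiv 2 ℂ (fun _ : Fin n => ℂ)).symm with hν
  have : ν.IsAddHaarMeasure := ContinuousLinearEquiv.isAddHaarMeasure_map
    (PiLp.continuousLinearEquiv 2 ℂ (fun _ : Fin n => ℂ)).symm volume
  let B : EuclideanSpace ℂ (Fin n) ≃ₗᵢ[ℝ] EuclideanSpace ℂ (Fin n) :=
    ⟨A.toLinearEquiv.restrictScalars ℝ, A.norm_map⟩
  have hB : MeasurePreserving A ν ν := by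
    rw [Measure.isAddLeftInvariant_eq_smul ν volume]
    exact (B.measurePreserving).smul_measure _
  have hd : Measurable fun v : EuclideanSpace ℂ (Fin n) =>
      ENNReal.ofReal (Real.exp (-‖v‖ ^ 2)) := by
    have : Continuous fun v : EuclideanSpace ℂ (Fin n) => Real.exp (-‖v‖ ^ 2) := by fun_prop
    exact ENNReal.measurable_ofReal.comp this.measurable
  rw [complexGaussian, withDensity_apply _ hS, withDensity_apply _ (A.continuous.measurable hS),
    ← hν, ← hB.setLIntegral_comp_preimage hS hd]
  simp only [LinearIsometryEquiv.norm_map]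

theorem complexGaussian_cone (m : ℕ) {δ : ℝ} (hδ0 : 0 < δ) (hδ1 : δ ≤ 1) :
    complexGaussian (m + 1) {v | (1 - δ ^ 2) * ‖v‖ ^ 2 ≤ ‖v 0‖ ^ 2} =
      ENNReal.ofReal (Real.pi ^ (m + 1) * δ ^ (2 * m)) := by
  have hδ2 : 0 < δ ^ 2 := by positivity
  have hcl : IsClosed {v : EuclideanSpace ℂ (Fin (m + 1)) |
      (1 - δ ^ 2) * ‖v‖ ^ 2 ≤ ‖v 0‖ ^ 2} :=
    isClosed_le (by fun_prop) (by fun_prop)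
  set t : ℝ := (1 - δ ^ 2) / δ ^ 2 with ht
  have ht0 : 0 ≤ t := div_nonneg (by nlinarith) hδ2.le
  have hmem : ∀ (z : ℂ) (w : Fin m → ℂ),
      (WithLp.toLp 2 (Fin.cons z w : Fin (m + 1) → ℂ) ∈
        {v : EuclideanSpace ℂ (Fin (m + 1)) | (1 - δ ^ 2) * ‖v‖ ^ 2 ≤ ‖v 0‖ ^ 2}) ↔
      t * ∑ i, ‖w i‖ ^ 2 ≤ ‖z‖ ^ 2 := by
    intro z w
    rw [Set.mem_ofPred_eq, EuclideanSpace.norm_sq_eq, Fin.sum_univ_succ]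
    simp only [Fin.cons_zero, Fin.cons_succ]
    rw [ht, div_mul_eq_mul_div, div_le_iff₀ hδ2]
    constructor <;> intro h <;> linarith
  have hmeas : Measurable ({x : Fin (m + 1) → ℂ | WithLp.toLp 2 x ∈
      {v : EuclideanSpace ℂ (Fin (m + 1)) | (1 - δ ^ 2) * ‖v‖ ^ 2 ≤ ‖v 0‖ ^ 2}}.indicator
      fun x => ENNReal.ofReal (Real.exp (-∑ i, ‖x i‖ ^ 2))) :=
    Measurable.indicator (by fun_prop) (hcl.preimage
      (PiLp.continuousLinearEquiv 2 ℂ (fun _ : Fin (m + 1) => ℂ)).symm.continuous).measurableSet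
  rw [complexGaussian_apply hcl.measurableSet, lintegral_fin_succ hmeas]
  have hinner : ∀ w : Fin m → ℂ, ∫⁻ z : ℂ, {x : Fin (m + 1) → ℂ | WithLp.toLp 2 x ∈
      {v : EuclideanSpace ℂ (Fin (m + 1)) | (1 - δ ^ 2) * ‖v‖ ^ 2 ≤ ‖v 0‖ ^ 2}}.indicator
      (fun x => ENNReal.ofReal (Real.exp (-∑ i, ‖x i‖ ^ 2))) (Fin.cons z w) =
      ENNReal.ofReal Real.pi *
        ENNReal.ofReal (Real.exp (-(1 / δ ^ 2) * ∑ i, ‖w i‖ ^ 2)) := by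
    intro w
    have hs : 0 ≤ t * ∑ i, ‖w i‖ ^ 2 := by positivity
    have hpt : ∀ z : ℂ, {x : Fin (m + 1) → ℂ | WithLp.toLp 2 x ∈
        {v : EuclideanSpace ℂ (Fin (m + 1)) | (1 - δ ^ 2) * ‖v‖ ^ 2 ≤ ‖v 0‖ ^ 2}}.indicator
        (fun x => ENNReal.ofReal (Real.exp (-∑ i, ‖x i‖ ^ 2))) (Fin.cons z w) =
        {z : ℂ | t * ∑ i, ‖w i‖ ^ 2 ≤ ‖z‖ ^ 2}.indicator
          (fun z => ENNReal.ofReal (Real.exp (-1 * ‖z‖ ^ 2))) z *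
          ENNReal.ofReal (Real.exp (-∑ i, ‖w i‖ ^ 2)) := by
      intro z
      by_cases h : t * ∑ i, ‖w i‖ ^ 2 ≤ ‖z‖ ^ 2
      · rw [Set.indicator_of_mem (by exact (hmem z w).2 h), Set.indicator_of_mem (by exact h),
          Fin.sum_univ_succ, ← ENNReal.ofReal_mul (Real.exp_nonneg _), ← Real.exp_add]
        simp only [Fin.cons_zero, Fin.cons_succ]
        congr 2
        ring
      · rw [Set.indicator_of_notMem (by exact fun h' => h ((hmem z w).1 h')),
          Set.indicator_of_notMem (by exact h), zero_mul]
    simp_rw [hpt]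
    rw [lintegral_mul_const' _ _ ENNReal.ofReal_ne_top,
      lintegral_gaussian_outside_disc one_pos hs, ← ENNReal.ofReal_mul (by positivity),
      ← ENNReal.ofReal_mul (by positivity), div_one, mul_assoc, ← Real.exp_add]
    congr 3
    rw [ht]
    field_simp
    ring
  simp_rw [hinner]
  rw [lintegral_const_mul' _ _ ENNReal.ofReal_ne_top, lintegral_gaussian_pi m (by positivity),
    ← ENNReal.ofReal_mul Real.pi_pos.le]
  congr 1
  rw [one_div, div_inv_eq_mul, mul_pow, ← pow_mul, pow_succ']
  ring

theorem complexGaussian_le_sqNormProj (m : ℕ) {δ : ℝ} (hδ0 : 0 < δ) (hδ1 : δ ≤ 1)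
    (Q : ℙ ℂ (EuclideanSpace ℂ (Fin (m + 1)))) :
    complexGaussian (m + 1) {v | (1 - δ ^ 2) * ‖v‖ ^ 2 ≤ sqNormProj v Q} =
      ENNReal.ofReal (Real.pi ^ (m + 1) * δ ^ (2 * m)) := by
  set e : EuclideanSpace ℂ (Fin (m + 1)) := EuclideanSpace.single 0 1 with he
  set u : EuclideanSpace ℂ (Fin (m + 1)) := ((‖Q.rep‖ : ℂ)⁻¹) • Q.rep with hu
  have hrep : ‖Q.rep‖ ≠ 0 := norm_ne_zero_iff.2 Q.rep_nonzero
  have hun : ‖u‖ = 1 := by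
    rw [hu, norm_smul]
    simp [hrep]
  obtain ⟨A, hA⟩ := exists_linearIsometryEquiv_apply_eq (u := u) (v := e) hun (by simp [he])
  have hproj : ∀ v, sqNormProj v Q = ‖A v 0‖ ^ 2 := by
    intro v
    have h1 : ‖⟪v, u⟫_ℂ‖ = ‖A v 0‖ := by
      rw [← A.inner_map_map, hA, he, EuclideanSpace.inner_single_right]
      simp
    rw [← h1, hu, inner_smul_right, norm_mul, sqNormProj]
    simp
    field_simp
  have hset : {v | (1 - δ ^ 2) * ‖v‖ ^ 2 ≤ sqNormProj v Q} =
      A ⁻¹' {v | (1 - δ ^ 2) * ‖v‖ ^ 2 ≤ ‖v 0‖ ^ 2} := by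
    ext v
    simp [hproj]
  have hcl : IsClosed {v : EuclideanSpace ℂ (Fin (m + 1)) |
      (1 - δ ^ 2) * ‖v‖ ^ 2 ≤ ‖v 0‖ ^ 2} :=
    isClosed_le (by fun_prop) (by fun_prop)
  rw [hset, complexGaussian_preimage A hcl.measurableSet, complexGaussian_cone m hδ0 hδ1]

/-- The mass of the lines whose angle to a fixed line has sine at most `δ`, for a unitarily
invariant probability measure. Integrating the incidence set over pairs (vector, line) against the
product with the Gaussian measure, in both orders, reduces it to a Gaussian integral. -/
theorem measure_le_sqNormProj (m : ℕ) (μ : Measure (ℙ ℂ (EuclideanSpace ℂ (Fin (m + 1)))))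
    [IsProbabilityMeasure μ]
    (hinv : ∀ A : EuclideanSpace ℂ (Fin (m + 1)) ≃ₗᵢ[ℂ] EuclideanSpace ℂ (Fin (m + 1)),
      ∀ s : Set (ℙ ℂ (EuclideanSpace ℂ (Fin (m + 1)))),
        μ (Projectivization.map (A.toLinearEquiv : EuclideanSpace ℂ (Fin (m + 1)) →ₗ[ℂ]
            EuclideanSpace ℂ (Fin (m + 1))) A.toLinearEquiv.injective ⁻¹' s) = μ s)
    {u : EuclideanSpace ℂ (Fin (m + 1))} (hu : ‖u‖ = 1)
    {δ : ℝ} (hδ0 : 0 < δ) (hδ1 : δ ≤ 1) :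
    μ {Q | 1 - δ ^ 2 ≤ sqNormProj u Q} = ENNReal.ofReal (δ ^ (2 * m)) := by
  have hmap : ∀ (A : EuclideanSpace ℂ (Fin (m + 1)) ≃ₗᵢ[ℂ] EuclideanSpace ℂ (Fin (m + 1)))
      (v : EuclideanSpace ℂ (Fin (m + 1))) (Q : ℙ ℂ (EuclideanSpace ℂ (Fin (m + 1)))),
      sqNormProj (A v) (Projectivization.map (A.toLinearEquiv : EuclideanSpace ℂ (Fin (m + 1)) →ₗ[ℂ]
        EuclideanSpace ℂ (Fin (m + 1))) A.toLinearEquiv.injective Q) = sqNormProj v Q := by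
    intro A v Q
    induction Q using Projectivization.ind with
    | h w hw =>
      rw [Projectivization.map_mk, sqNormProj_mk, sqNormProj_mk]
      change ‖⟪A v, A w⟫_ℂ‖ ^ 2 / ‖A w‖ ^ 2 = _
      rw [A.inner_map_map, A.norm_map]
  have hconst : ∀ v : EuclideanSpace ℂ (Fin (m + 1)), v ≠ 0 →
      μ {Q | (1 - δ ^ 2) * ‖v‖ ^ 2 ≤ sqNormProj v Q} = μ {Q | 1 - δ ^ 2 ≤ sqNormProj u Q} := by
    intro v hv
    have hv' : ‖v‖ ≠ 0 := norm_ne_zero_iff.2 hv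
    obtain ⟨A, hA⟩ := exists_linearIsometryEquiv_apply_eq (u := u)
      (v := ((‖v‖ : ℂ)⁻¹) • v) hu (by rw [norm_smul]; simp [hv'])
    rw [← hinv A]
    congr 1
    ext Q
    have hAv : v = (‖v‖ : ℂ) • A u := by
      rw [hA, smul_smul, mul_inv_cancel₀ (by exact_mod_cast hv'), one_smul]
    have hscale : ∀ R, sqNormProj v R = ‖v‖ ^ 2 * sqNormProj (A u) R := by
      intro R
      conv_lhs => rw [hAv]
      rw [sqNormProj, sqNormProj, inner_smul_left, norm_mul]
      simp
      ring
    rw [Set.mem_preimage, Set.mem_ofPred_eq, Set.mem_ofPred_eq, hscale, hmap, mul_comm]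
    exact mul_le_mul_iff_right₀ (by positivity)
  set S : Set (EuclideanSpace ℂ (Fin (m + 1)) × ℙ ℂ (EuclideanSpace ℂ (Fin (m + 1)))) :=
    {p | (1 - δ ^ 2) * ‖p.1‖ ^ 2 ≤ sqNormProj p.1 p.2} with hSdef
  have hS : MeasurableSet S := by
    have h1 : Measurable fun v : EuclideanSpace ℂ (Fin (m + 1)) => (1 - δ ^ 2) * ‖v‖ ^ 2 :=
      Continuous.measurable (by fun_prop)
    exact measurableSet_le (h1.comp measurable_fst) measurable_sqNormProj
  have h1 : ((complexGaussian (m + 1)).prod μ) S =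
      μ {Q | 1 - δ ^ 2 ≤ sqNormProj u Q} * ENNReal.ofReal (Real.pi ^ (m + 1)) := by
    rw [Measure.prod_apply hS, ← complexGaussian_univ, ← lintegral_const]
    refine lintegral_congr_ae ?_
    filter_upwards [ae_complexGaussian_ne_zero m] with v hv using hconst v hv
  have h2 : ((complexGaussian (m + 1)).prod μ) S =
      ENNReal.ofReal (Real.pi ^ (m + 1) * δ ^ (2 * m)) := by
    rw [Measure.prod_apply_symm hS]
    have h3 : ∀ Q, complexGaussian (m + 1) ((fun v => (v, Q)) ⁻¹' S) =
        ENNReal.ofReal (Real.pi ^ (m + 1) * δ ^ (2 * m)) :=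
      complexGaussian_le_sqNormProj m hδ0 hδ1
    simp [h3]
  have hpi : ENNReal.ofReal (Real.pi ^ (m + 1)) ≠ 0 := by
    simpa using pow_pos Real.pi_pos (m + 1)
  rw [h1, mul_comm (Real.pi ^ (m + 1)), ENNReal.ofReal_mul (by positivity)] at h2
  exact (ENNReal.mul_left_inj hpi ENNReal.ofReal_ne_top).1 h2

/-- In `G_{n,1}(ℂ) = ℂP^{n-1}` with the chordal distance
`d_c(P,Q) = sqrt(1 - |⟨u,v⟩|²)` (for unit representatives `u, v`) and the
unitary-invariant probability measure `μ`, the volume of a metric ball of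
radius `δ ≤ 1` equals `δ^{2(n-1)}`. -/
theorem stmt1 (n : ℕ) (hn : 1 ≤ n)
    (μ : Measure (ℙ ℂ (EuclideanSpace ℂ (Fin n)))) [IsProbabilityMeasure μ]
    (hinv : ∀ A : EuclideanSpace ℂ (Fin n) ≃ₗᵢ[ℂ] EuclideanSpace ℂ (Fin n),
      ∀ s : Set (ℙ ℂ (EuclideanSpace ℂ (Fin n))),
        μ (Projectivization.map (A.toLinearEquiv : EuclideanSpace ℂ (Fin n) →ₗ[ℂ]
            EuclideanSpace ℂ (Fin n)) A.toLinearEquiv.injective ⁻¹' s) = μ s)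
    (dc : ℙ ℂ (EuclideanSpace ℂ (Fin n)) → ℙ ℂ (EuclideanSpace ℂ (Fin n)) → ℝ)
    (hdc : ∀ (u v : EuclideanSpace ℂ (Fin n)) (hu : u ≠ 0) (hv : v ≠ 0),
      ‖u‖ = 1 → ‖v‖ = 1 →
      dc (Projectivization.mk ℂ u hu) (Projectivization.mk ℂ v hv)
        = Real.sqrt (1 - ‖⟪u, v⟫_ℂ‖ ^ 2))
    (P : ℙ ℂ (EuclideanSpace ℂ (Fin n))) (δ : ℝ) (hδ0 : 0 ≤ δ) (hδ1 : δ ≤ 1) :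
    μ {Q | dc P Q ≤ δ} = ENNReal.ofReal (δ ^ (2 * (n - 1))) := by
  obtain ⟨m, rfl⟩ : ∃ m, n = m + 1 := ⟨n - 1, by omega⟩
  rw [Nat.add_sub_cancel]
  obtain ⟨u, hu0, hu, rfl⟩ : ∃ (u : EuclideanSpace ℂ (Fin (m + 1))) (hu0 : u ≠ 0), ‖u‖ = 1 ∧
      P = Projectivization.mk ℂ u hu0 := by
    have hr : ‖P.rep‖ ≠ 0 := norm_ne_zero_iff.2 P.rep_nonzero
    have hr' : (‖P.rep‖ : ℂ)⁻¹ ≠ 0 := inv_ne_zero (by exact_mod_cast hr)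
    refine ⟨(‖P.rep‖ : ℂ)⁻¹ • P.rep, smul_ne_zero hr' P.rep_nonzero,
      by rw [norm_smul]; simp [hr], ?_⟩
    conv_lhs => rw [← P.mk_rep]
    exact ((Projectivization.mk_eq_mk_iff' ℂ _ _ _ _).2 ⟨_, rfl⟩).symm
  have hball : ∀ ε : ℝ, 0 ≤ ε → {Q | dc (Projectivization.mk ℂ u hu0) Q ≤ ε} =
      {Q | 1 - ε ^ 2 ≤ sqNormProj u Q} := by
    intro ε hε
    ext Q
    have hr : ‖Q.rep‖ ≠ 0 := norm_ne_zero_iff.2 Q.rep_nonzero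
    have hr' : (‖Q.rep‖ : ℂ)⁻¹ ≠ 0 := inv_ne_zero (by exact_mod_cast hr)
    have hw0 := smul_ne_zero hr' Q.rep_nonzero
    have hw : ‖(‖Q.rep‖ : ℂ)⁻¹ • Q.rep‖ = 1 := by rw [norm_smul]; simp [hr]
    have hQ : Q = Projectivization.mk ℂ ((‖Q.rep‖ : ℂ)⁻¹ • Q.rep) hw0 := by
      conv_lhs => rw [← Q.mk_rep]
      exact ((Projectivization.mk_eq_mk_iff' ℂ _ _ _ _).2 ⟨_, rfl⟩).symm
    generalize (‖Q.rep‖ : ℂ)⁻¹ • Q.rep = w at hw0 hw hQ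
    subst hQ
    rw [Set.mem_ofPred_eq, Set.mem_ofPred_eq, hdc u w hu0 hw0 hu hw, sqNormProj_mk, hw, one_pow,
      div_one, Real.sqrt_le_left hε]
    constructor <;> intro h <;> linarith
  rcases hδ0.eq_or_lt with rfl | hpos
  · have hlim : Filter.Tendsto (fun ε : ℝ => ENNReal.ofReal (ε ^ (2 * m)))
        (nhdsWithin 0 (Set.Ioi 0)) (nhds (ENNReal.ofReal ((0 : ℝ) ^ (2 * m)))) :=
      ((ENNReal.continuous_ofReal.comp (continuous_pow (2 * m))).tendsto 0).mono_left
        nhdsWithin_le_nhds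
    refine le_antisymm (ge_of_tendsto hlim ?_) ?_
    · filter_upwards [Ioc_mem_nhdsGT one_pos] with ε hε
      rw [← measure_le_sqNormProj m μ hinv hu hε.1 hε.2, ← hball ε hε.1.le]
      exact measure_mono fun Q hQ => le_trans (Set.mem_ofPred.1 hQ) hε.1.le
    · rcases Nat.eq_zero_or_pos m with rfl | hm
      · have huniv : {Q | dc (Projectivization.mk ℂ u hu0) Q ≤ 0} = Set.univ := by
          rw [hball 0 le_rfl]
          refine Set.eq_univ_of_forall fun Q => ?_
          have hr : ‖Q.rep‖ ^ 2 ≠ 0 := pow_ne_zero 2 (norm_ne_zero_iff.2 Q.rep_nonzero)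
          have hin : ‖⟪u, Q.rep⟫_ℂ‖ ^ 2 = ‖Q.rep‖ ^ 2 * ‖u‖ ^ 2 := by
            rw [EuclideanSpace.norm_sq_eq u, EuclideanSpace.norm_sq_eq Q.rep, PiLp.inner_apply]
            simp [mul_pow]
          rw [Set.mem_ofPred_eq, sqNormProj, hin, hu]
          simp [div_self hr]
        simp [huniv]
      · simp [hm.ne']
  · rw [hball δ hδ0, measure_le_sqNormProj m μ hinv hu hpos hδ1]
end

section
/- Let H ∈ ℂ^{L_R × L_T} with singular value decomposition, and let V_s ∈ ℂ^{L_T × s} consist of right singular vectors for the s largest singular values. Then for any P ∈ ℂ^{L_T × s} with P†P = I_s, log det(I + a H P P† H†) ≤ log det(I + a H V_s V_s† H†) = Σ_{i=1}^s log(1 + a λ_i), where a > 0 and λ_1 ≥ ... ≥ λ_s are the s largest eigenvalues of H†H. -/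
open Matrix Finset

open scoped ComplexOrder

namespace Matrix

variable {m n : Type*} [Fintype m] [DecidableEq m] [Fintype n] [DecidableEq n]

lemma PosSemidef.one_le_det_one_add {X : Matrix n n ℂ} (hX : X.PosSemidef) :
    1 ≤ (1 + X).det := by
  have hdet : (1 + X).det = ((∏ i, (1 + hX.isHermitian.eigenvalues i) : ℝ) : ℂ) := by
    have hU : star (hX.isHermitian.eigenvectorUnitary : Matrix n n ℂ) *
        hX.isHermitian.eigenvectorUnitary = 1 := Unitary.coe_star_mul_self _
    conv_lhs => rw [hX.isHermitian.spectral_theorem]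
    rw [Unitary.conjStarAlgAut_apply, mul_assoc, det_one_add_mul_comm, mul_assoc, hU, mul_one,
      ← diagonal_one, diagonal_add, det_diagonal]
    simp
  rw [hdet]
  exact_mod_cast Finset.one_le_prod fun i _ => le_add_of_nonneg_right (hX.eigenvalues_nonneg i)

open scoped MatrixOrder in
/-- The determinant is monotone in the Loewner order. -/
lemma PosDef.det_le_det_of_sub {A B : Matrix n n ℂ} (hA : A.PosDef)
    (hAB : (B - A).PosSemidef) : A.det ≤ B.det := by
  obtain ⟨K, hK⟩ := CStarAlgebra.nonneg_iff_eq_star_mul_self.mp hAB.nonneg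
  rw [star_eq_conjTranspose] at hK
  have hB : B = A * (1 + A⁻¹ * Kᴴ * K) := by
    rw [mul_add, mul_assoc, mul_one, mul_nonsing_inv_cancel_left _ _ hA.det_pos.ne'.isUnit, ← hK]
    abel
  have h := (hA.inv.posSemidef.mul_mul_conjTranspose_same K).one_le_det_one_add
  rw [hB, det_mul, det_one_add_mul_comm, ← mul_assoc]
  exact le_mul_of_one_le_right hA.det_pos.le h

lemma posSemidef_one_sub_self_mul_conjTranspose {Q : Matrix n m ℂ} (hQ : Qᴴ * Q = 1) :
    (1 - Q * Qᴴ).PosSemidef := by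
  have h : 1 - Q * Qᴴ = (1 - Q * Qᴴ)ᴴ * (1 - Q * Qᴴ) := by
    have h' : Q * Qᴴ * (Q * Qᴴ) = Q * Qᴴ := by
      rw [Matrix.mul_assoc, ← Matrix.mul_assoc Qᴴ, hQ, Matrix.one_mul]
    simp [sub_mul, mul_sub, h']
  rw [h]
  exact posSemidef_conjTranspose_mul_self _

/-- Compressing `1 + diag r²` to a subspace does not increase the determinant. -/
lemma det_one_add_compression_le {Q : Matrix n m ℂ} (hQ : Qᴴ * Q = 1) (r : n → ℝ) :
    (1 + Qᴴ * diagonal (fun i => ((r i ^ 2 : ℝ) : ℂ)) * Q).det ≤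
      ((∏ i, (1 + r i ^ 2) : ℝ) : ℂ) := by
  set R : Matrix n n ℂ := diagonal fun i => (r i : ℂ) with hR
  have hRR : diagonal (fun i => ((r i ^ 2 : ℝ) : ℂ)) = R * R := by
    simp [hR, diagonal_mul_diagonal, sq]
  have hRH : Rᴴ = R := by
    rw [hR, diagonal_conjTranspose]
    congr 1
    ext i
    simp
  have hprod : ((∏ i, (1 + r i ^ 2) : ℝ) : ℂ) = (1 + R * R).det := by
    rw [← hRR, ← diagonal_one, diagonal_add, det_diagonal]
    simp
  rw [hprod, hRR, show Qᴴ * (R * R) * Q = (Qᴴ * R) * (R * Q) by simp only [Matrix.mul_assoc],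
    det_one_add_mul_comm]
  refine PosDef.det_le_det_of_sub (PosDef.one.add_posSemidef ?_) ?_
  · convert posSemidef_self_mul_conjTranspose (R * Q) using 1
    rw [conjTranspose_mul, hRH]
  · convert (posSemidef_one_sub_self_mul_conjTranspose hQ).mul_mul_conjTranspose_same R using 1
    rw [hRH]
    simp only [Matrix.mul_sub, Matrix.sub_mul, Matrix.mul_assoc, Matrix.mul_one]
    abel

/-- Determinantal form of Cauchy interlacing for a nonnegative diagonal matrix with decreasing
entries. -/
lemma det_one_add_compression_le_prod {k s : ℕ} (hs : s ≤ k) {f : Fin k → ℝ}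
    (hf : Antitone f) (hf0 : ∀ i, 0 ≤ f i) {Q : Matrix (Fin k) (Fin s) ℂ} (hQ : Qᴴ * Q = 1) :
    (1 + Qᴴ * diagonal (fun i => (f i : ℂ)) * Q).det ≤
      ((∏ i : Fin s, (1 + f (Fin.castLE hs i)) : ℝ) : ℂ) := by
  obtain ⟨c, hc, hlt, hge⟩ : ∃ c : ℝ, 1 ≤ c ∧ (∀ i : Fin k, (i : ℕ) < s → c ≤ 1 + f i) ∧
      ∀ i : Fin k, s ≤ (i : ℕ) → 1 + f i ≤ c := by
    by_cases h : s < k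
    · exact ⟨1 + f ⟨s, h⟩, by linarith [hf0 ⟨s, h⟩],
        fun i hi => by linarith [hf (show i ≤ ⟨s, h⟩ from hi.le)],
        fun i hi => by linarith [hf (show ⟨s, h⟩ ≤ i from hi)]⟩
    · exact ⟨1, le_rfl, fun i _ => by linarith [hf0 i], fun i hi => by omega⟩
  have hc0 : 0 < c := by linarith
  set r : Fin k → ℝ := fun i => if (i : ℕ) < s then √((1 + f i) / c - 1) else 0 with hr
  have hr_lt (i : Fin k) (hi : (i : ℕ) < s) : c * (1 + r i ^ 2) = 1 + f i := by
    have h : 0 ≤ (1 + f i) / c - 1 := by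
      rw [sub_nonneg, one_le_div hc0]
      exact hlt i hi
    simp only [hr, hi, if_true, Real.sq_sqrt h]
    field_simp
    ring
  have hr_ge (i : Fin k) (hi : s ≤ (i : ℕ)) : r i = 0 := by simp [hr, hi.not_gt]
  have hdom (i : Fin k) : 0 ≤ c * (1 + r i ^ 2) - (1 + f i) := by
    rcases lt_or_ge (i : ℕ) s with hi | hi
    · rw [hr_lt i hi, sub_self]
    · rw [hr_ge i hi]
      linarith [hge i hi]
  have hstep : (1 + Qᴴ * diagonal (fun i => (f i : ℂ)) * Q).det ≤
      ((c : ℂ) • (1 + Qᴴ * diagonal (fun i => ((r i ^ 2 : ℝ) : ℂ)) * Q)).det := by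
    refine PosDef.det_le_det_of_sub (PosDef.one.add_posSemidef
      ((PosSemidef.diagonal fun i => ?_).conjTranspose_mul_mul_same Q)) ?_
    · simpa using hf0 i
    · have hD : (diagonal fun i => ((c * (1 + r i ^ 2) - (1 + f i) : ℝ) : ℂ)).PosSemidef :=
        PosSemidef.diagonal fun i => by
          simpa only [Pi.zero_apply, Complex.zero_le_real] using hdom i
      convert hD.conjTranspose_mul_mul_same Q using 1
      have hsplit : (diagonal fun i => ((c * (1 + r i ^ 2) - (1 + f i) : ℝ) : ℂ)) =
          (c : ℂ) • (1 + diagonal fun i => ((r i ^ 2 : ℝ) : ℂ)) -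
            (1 + diagonal fun i => (f i : ℂ)) := by
        rw [← diagonal_one, diagonal_add, diagonal_add, ← diagonal_smul, diagonal_sub]
        congr 1
        ext i
        simp
      rw [hsplit]
      simp only [Matrix.mul_sub, Matrix.sub_mul, Matrix.mul_add, Matrix.add_mul, Matrix.mul_smul,
        Matrix.smul_mul, Matrix.mul_one, hQ]
  refine hstep.trans ?_
  have hprod : ∏ i, (1 + r i ^ 2) = ∏ i : Fin s, (1 + r (Fin.castLE hs i) ^ 2) := by
    refine (Fintype.prod_of_injective (Fin.castLE hs) (Fin.castLE_injective hs) _ _ ?_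
      fun _ => rfl).symm
    intro i hi
    rw [hr_ge i, zero_pow two_ne_zero, add_zero]
    by_contra! h
    exact hi ⟨⟨i, h⟩, rfl⟩
  have hscale : ∏ i : Fin s, (1 + f (Fin.castLE hs i)) = c ^ s * ∏ i, (1 + r i ^ 2) := by
    rw [hprod, ← Fin.prod_const, ← Finset.prod_mul_distrib]
    exact Finset.prod_congr rfl fun i _ => (hr_lt _ i.isLt).symm
  rw [det_smul, Fintype.card_fin, hscale, Complex.ofReal_mul, Complex.ofReal_pow]
  exact mul_le_mul_of_nonneg_left (det_one_add_compression_le hQ r)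
    (by exact_mod_cast (pow_pos hc0 s).le)

end Matrix

/-- Optimality of top right-singular-vector beamforming. Let
`H ∈ ℂ^{L_R × L_T}` with eigendecomposition `H†H = W diag(d) W†` where `W` is
unitary and `d` is arranged in decreasing order, and let `V_s` consist of the
first `s` columns of `W` (right singular vectors of `H` for the `s` largest
singular values). Then for every semi-unitary `P ∈ ℂ^{L_T × s}` and `a > 0`,
`log det(I + a H P P† H†) ≤ log det(I + a H V_s V_s† H†) = Σ_{i=1}^s log(1 + a λ_i)`,
where `λ_1 ≥ ... ≥ λ_s` are the `s` largest eigenvalues of `H†H`. -/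
theorem stmt18 (Lr Lt s : ℕ) (hs : s ≤ Lt)
    (H : Matrix (Fin Lr) (Fin Lt) ℂ)
    (W : Matrix (Fin Lt) (Fin Lt) ℂ) (hW : W ∈ Matrix.unitaryGroup (Fin Lt) ℂ)
    (d : Fin Lt → ℝ) (hd : Antitone d) (hd0 : ∀ i, 0 ≤ d i)
    (hdecomp : Hᴴ * H = W * Matrix.diagonal (fun i => (d i : ℂ)) * Wᴴ)
    (Vs : Matrix (Fin Lt) (Fin s) ℂ)
    (hVs : Vs = W.submatrix id (Fin.castLE hs))
    (a : ℝ) (ha : 0 < a) :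
    (∀ P : Matrix (Fin Lt) (Fin s) ℂ, Pᴴ * P = 1 →
      Real.log ((1 + (a : ℂ) • (H * P * Pᴴ * Hᴴ)).det.re)
        ≤ Real.log ((1 + (a : ℂ) • (H * Vs * Vsᴴ * Hᴴ)).det.re)) ∧
    Real.log ((1 + (a : ℂ) • (H * Vs * Vsᴴ * Hᴴ)).det.re)
      = ∑ i : Fin s, Real.log (1 + a * d (Fin.castLE hs i)) := by
  have hWW : Wᴴ * W = 1 := (Matrix.mem_unitaryGroup_iff').mp hW
  have hWW' : W * Wᴴ = 1 := (Matrix.mem_unitaryGroup_iff).mp hW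
  have hdet (P : Matrix (Fin Lt) (Fin s) ℂ) :
      (1 + (a : ℂ) • (H * P * Pᴴ * Hᴴ)).det =
        (1 + (Wᴴ * P)ᴴ * diagonal (fun i => ((a * d i : ℝ) : ℂ)) * (Wᴴ * P)).det := by
    have hD : diagonal (fun i => ((a * d i : ℝ) : ℂ)) =
        (a : ℂ) • diagonal (fun i => (d i : ℂ)) := by
      rw [← diagonal_smul]
      congr 1
      ext i
      simp
    have h : Pᴴ * Hᴴ * (H * P) = (Wᴴ * P)ᴴ * diagonal (fun i => (d i : ℂ)) * (Wᴴ * P) := by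
      rw [show Pᴴ * Hᴴ * (H * P) = Pᴴ * (Hᴴ * H) * P by simp only [Matrix.mul_assoc], hdecomp]
      simp only [conjTranspose_mul, conjTranspose_conjTranspose, Matrix.mul_assoc]
    rw [hD, Matrix.mul_smul, Matrix.smul_mul, ← h, Matrix.mul_assoc (H * P), ← Matrix.smul_mul,
      det_one_add_mul_comm, Matrix.mul_smul]
  have hpos (i : Fin s) : 0 < 1 + a * d (Fin.castLE hs i) := by
    have := mul_nonneg ha.le (hd0 (Fin.castLE hs i))
    linarith
  have hVdet : (1 + (a : ℂ) • (H * Vs * Vsᴴ * Hᴴ)).det =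
      ((∏ i : Fin s, (1 + a * d (Fin.castLE hs i)) : ℝ) : ℂ) := by
    have hV : Wᴴ * Vs = (1 : Matrix (Fin Lt) (Fin Lt) ℂ).submatrix id (Fin.castLE hs) := by
      rw [hVs, ← hWW, submatrix_mul _ _ _ id _ Function.bijective_id, submatrix_id_id]
    have hcomp : (Wᴴ * Vs)ᴴ * diagonal (fun i => ((a * d i : ℝ) : ℂ)) * (Wᴴ * Vs) =
        diagonal (fun i => ((a * d (Fin.castLE hs i) : ℝ) : ℂ)) := by
      rw [hV]
      ext i j
      simp only [Matrix.mul_apply, diagonal_apply, one_apply, conjTranspose_apply, submatrix_apply]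
      rcases eq_or_ne i j with rfl | hij
      · simp
      · simp [hij, hij.symm]
    rw [hdet, hcomp, ← diagonal_one, diagonal_add, det_diagonal]
    simp
  refine ⟨fun P hP => ?_, ?_⟩
  · have hQ : (Wᴴ * P)ᴴ * (Wᴴ * P) = 1 := by
      rw [conjTranspose_mul, conjTranspose_conjTranspose, Matrix.mul_assoc, ← Matrix.mul_assoc W,
        hWW', Matrix.one_mul, hP]
    have hle := det_one_add_compression_le_prod hs (f := fun i => a * d i)
      (fun i j hij => mul_le_mul_of_nonneg_left (hd hij) ha.le)
      (fun i => mul_nonneg ha.le (hd0 i)) hQ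
    have hpsd : (diagonal fun i => ((a * d i : ℝ) : ℂ)).PosSemidef :=
      PosSemidef.diagonal fun i => by
        simpa only [Pi.zero_apply, Complex.zero_le_real] using mul_nonneg ha.le (hd0 i)
    have hone := (hpsd.conjTranspose_mul_mul_same (Wᴴ * P)).one_le_det_one_add
    rw [hVdet, hdet]
    refine Real.log_le_log ?_ (Complex.le_def.mp hle).1
    exact zero_lt_one.trans_le (Complex.le_def.mp hone).1
  · rw [hVdet, Complex.ofReal_re, Real.log_prod fun i _ => (hpos i).ne']
end
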